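/- arXiv:1412.5655 — 2 statements merged into one kernel-verified Lean document; each statement's English description precedes it below -/
import Mathlib

section
/- There exists a universal constant c > 0 such that the following holds for all n ≥ 2 and all ε with 1/n ≤ ε ≤ 1/2. Let M be a matching of σ·2^n edges of the hypercube all of whose endpoints lie in L_mid, i.e., a set of pairs (x,y) with x ≺ y, ‖y−x‖₁ = 1, x, y ∈ L_mid, no two pairs sharing a vertex, and |M| = σ·2^n. Let A = {x : (x,y) ∈ M for some y} be the lower endpoints and A_u = {y : (x,y) ∈ M for some x} the upper endpoints. Then there exists an integer ℓ with 0 ≤ ℓ ≤ m = ⌈log₂(n+1)⌉ such that Σ_{y ∈ A_u} Σ_{k ∈ B′_ℓ} dens↓_k(y,A) ≥ c·2^{ℓ+n}·ε⁸·σ² / ((log₂ n)·√(n·ln(1/ε))). -/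
open Finset

/-- The Hamming weight `‖x‖₁` of `x ∈ {0,1}^n`. -/
def wt {n : ℕ} (x : Fin n → Bool) : ℕ :=
  (Finset.univ.filter (fun i => x i = true)).card

/-- The Hamming distance `‖x − y‖₁`. -/
def hamm {n : ℕ} (x y : Fin n → Bool) : ℕ :=
  (Finset.univ.filter (fun i => x i ≠ y i)).card

/-- The parameter `d = d(n,ε) = 2⌈√(2n·ln(100/ε))⌉`. -/
noncomputable def dPar (n : ℕ) (ε : ℝ) : ℕ :=
  2 * ⌈Real.sqrt (2 * n * Real.log (100 / ε))⌉₊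

open Classical in
/-- The middle layers `L_mid = {x : (n−d)/2 ≤ ‖x‖₁ ≤ (n+d)/2}`. -/
noncomputable def Lmid (n : ℕ) (ε : ℝ) : Finset (Fin n → Bool) :=
  Finset.univ.filter (fun x =>
    ((n : ℝ) - dPar n ε) / 2 ≤ (wt x : ℝ) ∧ (wt x : ℝ) ≤ ((n : ℝ) + dPar n ε) / 2)

/-- The `j`-th point (from the bottom) of the path from `0^n` to `1^n` determined by the
permutation `π`: its ones are exactly in positions `π(0),…,π(j−1)`. -/
def pathPoint {n : ℕ} (π : Equiv.Perm (Fin n)) (j : ℕ) : Fin n → Bool :=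
  fun i => decide ((π.symm i : ℕ) < j)

/-- The indices `j` of the points of the path `π` lying in the middle layers `L_mid`. -/
noncomputable def pmidIdx (n : ℕ) (ε : ℝ) (π : Equiv.Perm (Fin n)) : Finset ℕ :=
  (Finset.range (n + 1)).filter (fun j => pathPoint π j ∈ Lmid n ε)

open Classical in
/-- `dens↓_k(x,A)`: the probability that a uniformly random `y ≼ x` with `‖x−y‖₁ = k`
lies in `A` (if `k ≤ ‖x‖₁`, and `0` otherwise). -/
noncomputable def densDown {n : ℕ} (x : Fin n → Bool) (A : Finset (Fin n → Bool)) (k : ℕ) : ℝ :=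
  if k ≤ wt x then
    ((A.filter (fun y => (∀ i, y i ≤ x i) ∧ hamm y x = k)).card : ℝ) / ((wt x).choose k : ℝ)
  else 0

open Classical in
/-- `dens↑_k(x,A)`: the probability that a uniformly random `y ≽ x` with `‖y−x‖₁ = k`
lies in `A` (if `k ≤ n − ‖x‖₁`, and `0` otherwise). -/
noncomputable def densUp {n : ℕ} (x : Fin n → Bool) (A : Finset (Fin n → Bool)) (k : ℕ) : ℝ :=
  if k ≤ n - wt x then
    ((A.filter (fun y => (∀ i, x i ≤ y i) ∧ hamm x y = k)).card : ℝ) / ((n - wt x).choose k : ℝ)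
  else 0

/-- `score↓(x,A) = Σ_{k=0}^n dens↓_k(x,A)`. -/
noncomputable def scoreDown {n : ℕ} (x : Fin n → Bool) (A : Finset (Fin n → Bool)) : ℝ :=
  ∑ k ∈ Finset.range (n + 1), densDown x A k

/-- `score↑(x,A) = Σ_{k=1}^n dens↑_k(x,A)`. -/
noncomputable def scoreUp {n : ℕ} (x : Fin n → Bool) (A : Finset (Fin n → Bool)) : ℝ :=
  ∑ k ∈ Finset.Icc 1 n, densUp x A k

/-- The buckets: `B₀ = {0}` and `B_i = {2^{i−1},…,2^i − 1}` for `i ≥ 1`. -/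
def bucket (i : ℕ) : Finset ℕ := if i = 0 then {0} else Finset.Ico (2 ^ (i - 1)) (2 ^ i)

/-- `B′_i = {j + 1 : j ∈ B_i}`. -/
def bucket' (i : ℕ) : Finset ℕ := (bucket i).image (· + 1)

/-- The number of buckets minus one: `m = ⌈log₂(n+1)⌉`. -/
def mPar (n : ℕ) : ℕ := Nat.clog 2 (n + 1)


noncomputable def gbU {α : Type*} (F : Finset α → ℝ) (x : Finset α) : ℝ :=
  ∑ z ∈ x.powerset, F z / ((#x).choose (#z) : ℝ)

lemma gbU_rec {α : Type*} [DecidableEq α] (F : Finset α → ℝ) (x : Finset α) (hx : x.Nonempty) :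
    gbU F x = F x + (∑ i ∈ x, gbU F (x.erase i)) / (#x : ℝ) := by
  have hc : 0 < #x := hx.card_pos
  have h1 : ∑ i ∈ x, gbU F (x.erase i)
      = ∑ z ∈ x.ssubsets, ∑ i ∈ x \ z, F z / ((#x - 1).choose (#z) : ℝ) := by
    unfold gbU
    rw [Finset.sum_congr rfl (fun i hi => by rw [Finset.card_erase_of_mem hi])]
    apply Finset.sum_comm'
    intro i z
    simp only [mem_powerset, mem_ssubsets, mem_sdiff, Finset.subset_erase, Finset.ssubset_iff_subset_ne]
    constructor
    · rintro ⟨hi, hz, hiz⟩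
      exact ⟨⟨hi, hiz⟩, hz, fun h => hiz (h ▸ hi)⟩
    · rintro ⟨⟨hi, hiz⟩, hz, -⟩
      exact ⟨hi, hz, hiz⟩
  rw [h1]
  unfold gbU
  have h2 : x.powerset = insert x x.ssubsets := by
    rw [ssubsets, Finset.insert_erase (mem_powerset_self x)]
  rw [h2, Finset.sum_insert (by simp), Finset.sum_div]
  simp only [Nat.choose_self, Nat.cast_one, div_one]
  congr 1
  apply Finset.sum_congr rfl
  intro z hz
  have hz' := mem_ssubsets.1 hz
  have hlt := card_lt_card hz'
  rw [Finset.sum_const, card_sdiff_of_subset hz'.subset, nsmul_eq_mul]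
  obtain ⟨N, hN⟩ : ∃ N, #x = N + 1 := ⟨#x - 1, by omega⟩
  rw [hN] at hlt ⊢
  have hk : #z ≤ N := by omega
  have e := Nat.add_one_mul_choose_eq N (#z)
  have e2 : (N + 1).choose (#z) * (N + 1 - #z) = (N + 1) * N.choose (#z) := by
    rw [mul_comm (N+1)]; exact (Nat.choose_mul_succ_eq N (#z)).symm
  have p1 : (0:ℝ) < (N + 1).choose (#z) := by exact_mod_cast Nat.choose_pos (by omega)
  have p2 : (0:ℝ) < N.choose (#z) := by exact_mod_cast Nat.choose_pos hk
  have e3 : ((N + 1).choose (#z) : ℝ) * ((N + 1 - #z : ℕ) : ℝ) = (N + 1) * N.choose (#z) := by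
    exact_mod_cast e2
  simp only [Nat.add_sub_cancel]
  push_cast
  field_simp
  linear_combination (-F z) * e3

lemma gbU_sq {α : Type*} [DecidableEq α] (F : Finset α → ℝ) (x : Finset α) :
    (gbU F x) ^ 2 / 2 ≤ gbU (fun z => F z * gbU F z) x := by
  induction x using Finset.strongInduction with
  | H x ih =>
    rcases x.eq_empty_or_nonempty with rfl | hx
    · simp [gbU]; nlinarith [sq_nonneg (F ∅)]
    · have hc : (0:ℝ) < #x := by exact_mod_cast hx.card_pos
      have h1 : ∑ i ∈ x, (gbU F (x.erase i)) ^ 2 / 2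
          ≤ ∑ i ∈ x, gbU (fun z => F z * gbU F z) (x.erase i) :=
        Finset.sum_le_sum fun i hi => ih _ (erase_ssubset hi)
      have h2 := sq_sum_le_card_mul_sum_sq (s := x) (f := fun i => gbU F (x.erase i))
      rw [gbU_rec (fun z => F z * gbU F z) x hx]
      rw [gbU_rec F x hx]
      rw [← Finset.sum_div] at h1
      set s := ∑ i ∈ x, gbU F (x.erase i)
      set q := ∑ i ∈ x, (gbU F (x.erase i)) ^ 2
      set r := ∑ i ∈ x, gbU (fun z => F z * gbU F z) (x.erase i)
      have h3 : (s / #x) ^ 2 / 2 ≤ r / #x := by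
        have : (s / #x) ^ 2 ≤ q / #x := by
          rw [div_pow, div_le_div_iff₀ (by positivity) hc]
          nlinarith
        have h4 : q / 2 / #x ≤ r / #x := by gcongr
        have h5 : q / 2 / (#x : ℝ) = q / #x / 2 := by ring
        linarith
      nlinarith [sq_nonneg (F x)]

lemma cb_upper (k : ℕ) : (2 * k + 1) * k.centralBinom ^ 2 ≤ 16 ^ k := by
  induction k with
  | zero => simp
  | succ k ih =>
    have h := Nat.succ_mul_centralBinom_succ k
    set a := (k+1).centralBinom
    set b := k.centralBinom
    have : (k+1)^2 * ((2 * (k + 1) + 1) * a ^ 2) ≤ (k+1)^2 * 16 ^ (k+1) := by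
      calc (k+1)^2 * ((2 * (k + 1) + 1) * a ^ 2) = (2*k+3) * ((k+1) * a)^2 := by ring
        _ = (2*k+3) * (2 * (2 * k + 1) * b)^2 := by rw [h]
        _ = (4 * (2*k+3) * (2*k+1)) * ((2*k+1) * b^2) := by ring
        _ ≤ (16 * (k+1)^2) * 16^k := by
          apply Nat.mul_le_mul _ ih
          nlinarith
        _ = _ := by ring
    exact Nat.le_of_mul_le_mul_left this (by positivity)

lemma cb_lower (k : ℕ) (hk : 1 ≤ k) : 16 ^ k ≤ 4 * k * k.centralBinom ^ 2 := by
  induction k, hk using Nat.le_induction with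
  | base => simp [Nat.centralBinom]
  | succ k hk ih =>
    have h := Nat.succ_mul_centralBinom_succ k
    set a := (k+1).centralBinom
    set b := k.centralBinom
    have : (k+1) * 16 ^ (k+1) ≤ (k+1) * (4 * (k+1) * a ^ 2) := by
      calc (k+1) * 16 ^ (k+1) = 16 * (k+1) * 16^k := by ring
        _ ≤ 16 * (k+1) * (4 * k * b^2) := by gcongr
        _ = (16 * 4 * k * (k+1)) * b^2 := by ring
        _ ≤ (4 * (2 * (2*k+1))^2) * b^2 := by
          apply Nat.mul_le_mul_right
          nlinarith
        _ = 4 * (2 * (2 * k + 1) * b)^2 := by ring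
        _ = 4 * ((k+1) * a)^2 := by rw [h]
        _ = _ := by ring
    exact Nat.le_of_mul_le_mul_left this (by positivity)

lemma mid_bounds (n : ℕ) (hn : 1 ≤ n) :
    n * (n.choose (n/2)) ^ 2 ≤ 4 ^ n ∧ 4 ^ n ≤ 4 * n * (n.choose (n/2)) ^ 2 := by
  rcases Nat.even_or_odd' n with ⟨k, rfl | rfl⟩
  · have e : 2 * k / 2 = k := by omega
    rw [e, ← Nat.centralBinom_eq_two_mul_choose, pow_mul]
    have h1 := cb_upper k
    have h2 := cb_lower k (by omega)
    norm_num
    constructor <;> nlinarith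
  · have e : (2 * k + 1) / 2 = k := by omega
    have h1 := cb_upper (k+1)
    have h2 := cb_lower (k+1) (by omega)
    have h3 : (k+1).centralBinom = 2 * (2*k+1).choose k := by
      rw [Nat.centralBinom_eq_two_mul_choose, show 2 * (k+1) = (2*k+1)+1 by ring,
        Nat.choose_succ_succ, Nat.choose_symm_half]; ring
    rw [e]
    rw [h3] at h1 h2
    set a := (2*k+1).choose k
    have h4 : 4 ^ (2*k+1) * 4 = 16 ^ (k+1) := by
      rw [show (16:ℕ) = 4^2 by norm_num, ← pow_mul]; ring
    constructor
    · nlinarith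
    · nlinarith [Nat.zero_le (k * a^2)]

lemma exp_step (u : ℝ) (h0 : 0 ≤ u) (h1 : u ≤ 1/2) : Real.exp (-(2*u)) ≤ 1 - u := by
  rw [Real.exp_neg]
  have h := Real.add_one_le_exp (2*u)
  have : (Real.exp (2*u))⁻¹ ≤ (2*u+1)⁻¹ := by gcongr
  refine this.trans ?_
  rw [inv_le_iff_one_le_mul₀ (by positivity)]
  nlinarith

lemma choose_lower_aux (n s : ℕ) (hn : 1 ≤ n) (hs : 8 * s ≤ n) :
    (n.choose (n/2) : ℝ) * Real.exp (-(4 * s * (s+1) / n)) ≤ n.choose ((n+1)/2 + s) := by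
  induction s with
  | zero =>
    have : n.choose (n/2) = n.choose ((n+1)/2) := by
      rw [← Nat.choose_symm (show n/2 ≤ n by omega)]; congr 1; omega
    simp [this]
  | succ s ih =>
    have ih := ih (by omega)
    set h := (n+1)/2 with hh
    have hn0 : (0:ℝ) < n := by exact_mod_cast hn
    have hle : h + s ≤ n := by omega
    have e : (n.choose (h+s+1) : ℝ) * (h+s+1) = n.choose (h+s) * ((n:ℝ) - (h+s)) := by
      have := Nat.choose_succ_right_eq n (h+s)
      have e2 : ((n - (h+s) : ℕ) : ℝ) = (n:ℝ) - (h+s) := by rw [Nat.cast_sub hle]; push_cast; ring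
      rw [← e2]; exact_mod_cast this
    have hh1 : (2 * h : ℝ) ≤ n + 1 := by exact_mod_cast (by omega : 2 * h ≤ n + 1)
    have hh2 : (n : ℝ) ≤ 2 * h := by exact_mod_cast (by omega : n ≤ 2 * h)
    have hs' : (8 * (s+1) : ℝ) ≤ n := by exact_mod_cast hs
    have st := exp_step (4 * (s+1) / n) (by positivity) (by rw [div_le_iff₀ hn0]; linarith)
    have hr : (1 - 4 * (s+1) / n : ℝ) * (h+s+1) ≤ (n:ℝ) - (h+s) := by
      have : (4 * (s+1) / n : ℝ) * (h+s+1) ≥ 2 * s + 2 := by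
        rw [ge_iff_le, div_mul_eq_mul_div, le_div_iff₀ hn0]
        have : (0:ℝ) ≤ s := by positivity
        nlinarith
      nlinarith
    have eexp : Real.exp (-(4 * ((s+1 : ℕ):ℝ) * (((s+1:ℕ):ℝ)+1) / n))
        = Real.exp (-(4 * s * (s+1) / n)) * Real.exp (-(2 * (4 * (s+1) / n))) := by
      rw [← Real.exp_add]; congr 1; push_cast; ring
    rw [eexp, ← mul_assoc, ← add_assoc]
    have p : (0:ℝ) < (h:ℝ)+s+1 := by positivity
    refine le_of_mul_le_mul_right ?_ p
    rw [e]
    calc _ ≤ (n.choose (h+s) : ℝ) * (1 - 4 * (s+1) / n) * (h+s+1) := by gcongr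
      _ = n.choose (h+s) * ((1 - 4 * (s+1) / n) * (h+s+1)) := by ring
      _ ≤ _ := by gcongr

lemma t_bound : ∃ N0 : ℕ, ∀ n : ℕ, N0 ≤ n → ∀ ε : ℝ, 1 / (n:ℝ) ≤ ε → ε ≤ 1/2 →
    8 * ⌈Real.sqrt (2 * n * Real.log (100 / ε))⌉₊ ≤ n := by
  refine ⟨10240 ^ 2, fun n hn ε h1 h2 => ?_⟩
  have hn' : ((10240:ℝ)) ^ 2 ≤ n := by exact_mod_cast hn
  have hn0 : (0:ℝ) < n := by linarith
  have he : 0 < ε := lt_of_lt_of_le (by positivity) h1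
  have hsq : (10240:ℝ) ≤ Real.sqrt n := Real.le_sqrt_of_sq_le hn'
  have hss : Real.sqrt n ^ 2 = n := Real.sq_sqrt hn0.le
  have hlog : Real.log (100 / ε) ≤ 20 * Real.sqrt n := by
    have : 100 / ε ≤ (10 * Real.sqrt n) ^ 2 := by
      rw [mul_pow, hss, div_le_iff₀ he]
      rw [div_le_iff₀ hn0] at h1
      nlinarith
    have h3 := Real.log_le_log (by positivity) this
    rw [Real.log_pow] at h3
    have h4 := Real.log_le_self (show 0 ≤ 10 * Real.sqrt n by positivity)
    push_cast at h3
    linarith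
  have hr : Real.sqrt (2 * n * Real.log (100 / ε)) ≤ n / 16 := by
    apply Real.sqrt_le_iff.2 ⟨by positivity, ?_⟩
    calc 2 * n * Real.log (100 / ε) ≤ 2 * n * (20 * Real.sqrt n) := by gcongr
      _ ≤ (n/16)^2 := by
        have : 40 * Real.sqrt n ≤ n / 256 := by nlinarith
        nlinarith
  have hc := Nat.ceil_lt_add_one (Real.sqrt_nonneg (2 * n * Real.log (100 / ε)))
  have : (8 * (⌈Real.sqrt (2 * n * Real.log (100 / ε))⌉₊ : ℝ)) ≤ n := by linarith
  exact_mod_cast this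

lemma choose_lower_main (n : ℕ) (hn : 2 ≤ n) (ε : ℝ) (h1 : 1 / (n:ℝ) ≤ ε) (h2 : ε ≤ 1/2)
    (t : ℕ) (ht : t = ⌈Real.sqrt (2 * n * Real.log (100 / ε))⌉₊) (ht8 : 8 * t ≤ n)
    (s : ℕ) (hs : s ≤ t) :
    (Real.exp (-10) / (2 * 100 ^ 8)) * 2 ^ n * ε ^ 8 / Real.sqrt n ≤ n.choose ((n+1)/2 + s) := by
  refine le_trans ?_ (choose_lower_aux n s (by omega) (by omega))
  have hn0 : (0:ℝ) < n := by positivity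
  have hn2 : (2:ℝ) ≤ n := by exact_mod_cast hn
  have he : 0 < ε := lt_of_lt_of_le (by positivity) h1
  have hL : 0 ≤ Real.log (100 / ε) := Real.log_nonneg (by rw [le_div_iff₀ he]; linarith)
  set r := Real.sqrt (2 * n * Real.log (100 / ε)) with hr
  have hr0 : 0 ≤ r := Real.sqrt_nonneg _
  have hr2 : r ^ 2 = 2 * n * Real.log (100 / ε) := Real.sq_sqrt (by positivity)
  have htr : (t:ℝ) < r + 1 := ht ▸ Nat.ceil_lt_add_one hr0
  have hrt : r ≤ t := ht ▸ Nat.le_ceil r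
  have ht8' : 8 * (t:ℝ) ≤ n := by exact_mod_cast ht8
  have hs' : (s:ℝ) ≤ t := by exact_mod_cast hs
  have hs0 : (0:ℝ) ≤ s := by positivity
  have hexp : Real.exp (-10) * (ε / 100) ^ 8 ≤ Real.exp (-(4 * s * (s+1) / n)) := by
    have e1 : (ε / 100) ^ 8 = Real.exp (-(8 * Real.log (100/ε))) := by
      have : Real.log (100 / ε) = - Real.log (ε / 100) := by rw [← Real.log_inv, inv_div]
      rw [this, show -(8 * -Real.log (ε/100)) = ((8:ℕ):ℝ) * Real.log (ε/100) by push_cast; ring,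
        Real.exp_nat_mul, Real.exp_log (by positivity)]
    rw [e1, ← Real.exp_add]
    apply Real.exp_le_exp.2
    have : 4 * (s:ℝ) * (s+1) / n ≤ 8 * Real.log (100/ε) + 10 := by
      rw [div_le_iff₀ hn0]
      nlinarith
    linarith
  have hmid : (2:ℝ) ^ n / (2 * Real.sqrt n) ≤ n.choose (n/2) := by
    have := (mid_bounds n (by omega)).2
    have h' : (4:ℝ) ^ n ≤ 4 * n * (n.choose (n/2) : ℝ) ^ 2 := by exact_mod_cast this
    rw [div_le_iff₀ (by positivity)]
    apply le_of_sq_le_sq _ (by positivity) |> fun h => h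
    rw [mul_pow, mul_pow, Real.sq_sqrt hn0.le, ← pow_mul, mul_comm n 2, pow_mul]
    norm_num
    linarith
  calc _ = (2:ℝ) ^ n / (2 * Real.sqrt n) * (Real.exp (-10) * (ε / 100) ^ 8) := by
        rw [div_pow]; field_simp
    _ ≤ _ := by gcongr

lemma choose_lower : ∃ c : ℝ, 0 < c ∧ ∀ n : ℕ, 2 ≤ n → ∀ ε : ℝ, 1 / (n:ℝ) ≤ ε → ε ≤ 1/2 →
    ∀ w : ℕ, w ≤ n → ((n : ℝ) - dPar n ε) / 2 ≤ (w : ℝ) → (w : ℝ) ≤ ((n : ℝ) + dPar n ε) / 2 →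
    c * 2 ^ n * ε ^ 8 / Real.sqrt n ≤ n.choose w := by
  obtain ⟨N0, hN⟩ := t_bound
  refine ⟨min (1 / 2 ^ N0) (Real.exp (-10) / (2 * 100 ^ 8)), by positivity, ?_⟩
  intro n hn ε h1 h2 w hw hw1 hw2
  have hn2 : (2:ℝ) ≤ n := by exact_mod_cast hn
  have he : 0 < ε := lt_of_lt_of_le (by positivity) h1
  by_cases hnN : N0 ≤ n
  · have ht8 := hN n hnN ε h1 h2
    have hle : min (1 / 2 ^ N0) (Real.exp (-10) / (2 * 100 ^ 8)) * 2 ^ n * ε ^ 8 / Real.sqrt n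
        ≤ (Real.exp (-10) / (2 * 100 ^ 8)) * 2 ^ n * ε ^ 8 / Real.sqrt n := by
      gcongr
      exact min_le_right _ _
    refine hle.trans ?_
    unfold dPar at hw1 hw2
    set t := ⌈Real.sqrt (2 * n * Real.log (100 / ε))⌉₊ with ht
    push_cast at hw1 hw2
    have hw1' : n ≤ 2 * w + 2 * t := by
      have : (n:ℝ) ≤ 2 * w + 2 * t := by linarith
      exact_mod_cast this
    have hw2' : 2 * w ≤ n + 2 * t := by
      have : (2:ℝ) * w ≤ n + 2 * t := by linarith
      exact_mod_cast this
    by_cases hc : (n+1)/2 ≤ w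
    · have := choose_lower_main n hn ε h1 h2 t ht ht8 (w - (n+1)/2) (by omega)
      rwa [Nat.add_sub_cancel' hc] at this
    · have := choose_lower_main n hn ε h1 h2 t ht ht8 (n - w - (n+1)/2) (by omega)
      rwa [Nat.add_sub_cancel' (by omega), Nat.choose_symm hw] at this
  · have hp : (1:ℝ) ≤ n.choose w := by exact_mod_cast Nat.choose_pos hw
    refine le_trans ?_ hp
    have hsq : 1 ≤ Real.sqrt n := by rw [Real.one_le_sqrt]; linarith
    have he8 : ε ^ 8 ≤ 1 := pow_le_one₀ he.le (by linarith)
    have hpow : (2:ℝ) ^ n ≤ 2 ^ N0 := pow_le_pow_right₀ (by norm_num) (by omega)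
    rw [div_le_one (by positivity)]
    refine le_trans ?_ hsq
    calc _ ≤ (1 / 2 ^ N0 : ℝ) * 2 ^ N0 * 1 := by
          gcongr
          exact min_le_left _ _
      _ = 1 := by field_simp

lemma sum_buckets (f : ℕ → ℝ) (m : ℕ) :
    ∑ l ∈ Finset.range (m + 1), ∑ k ∈ bucket l, f k = ∑ k ∈ Finset.range (2 ^ m), f k := by
  induction m with
  | zero => simp [bucket]
  | succ m ih =>
    rw [Finset.sum_range_succ, ih]
    simp only [bucket, Nat.succ_ne_zero, if_false, Nat.add_sub_cancel]
    exact Finset.sum_range_add_sum_Ico f (Nat.pow_le_pow_right (by norm_num) (by omega))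

/-- The support of a Boolean vector. -/
def supp {n : ℕ} (x : Fin n → Bool) : Finset (Fin n) := Finset.univ.filter (fun i => x i = true)

lemma supp_inj {n : ℕ} : Function.Injective (supp (n := n)) := by
  intro x y h
  funext i
  have h1 := Finset.ext_iff.1 h i
  simp only [supp, mem_filter, mem_univ, true_and] at h1
  exact Bool.eq_iff_iff.2 h1

lemma card_supp {n : ℕ} (x : Fin n → Bool) : #(supp x) = wt x := rfl

lemma supp_subset {n : ℕ} (x y : Fin n → Bool) : supp x ⊆ supp y ↔ ∀ i, x i ≤ y i := by
  simp only [supp, Finset.subset_iff, mem_filter, mem_univ, true_and, Bool.le_iff_imp]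

lemma wt_le {n : ℕ} (x : Fin n → Bool) : wt x ≤ n := by
  have := Finset.card_le_univ (supp x)
  simpa [card_supp] using this

lemma hamm_add {n : ℕ} (y x : Fin n → Bool) (h : ∀ i, y i ≤ x i) : hamm y x + wt y = wt x := by
  have h1 : Finset.univ.filter (fun i => y i ≠ x i) = supp x \ supp y := by
    ext i
    have := h i
    simp only [supp, mem_filter, mem_univ, true_and, mem_sdiff]
    revert this
    cases x i <;> cases y i <;> simp
  unfold hamm
  rw [h1, ← card_supp, ← card_supp]
  exact Finset.card_sdiff_add_card_eq_card ((supp_subset y x).2 h)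

lemma densDown_nonneg {n : ℕ} (x : Fin n → Bool) (A : Finset (Fin n → Bool)) (k : ℕ) :
    0 ≤ densDown x A k := by
  unfold densDown; split_ifs <;> positivity

open Classical in
lemma dens_sum {n : ℕ} (x : Fin n → Bool) (A : Finset (Fin n → Bool)) :
    gbU (fun z => if z ∈ A.image supp then (1:ℝ) else 0) (supp x)
      = ∑ k ∈ Finset.range (n + 1), densDown x A k := by
  have h1 : gbU (fun z => if z ∈ A.image supp then (1:ℝ) else 0) (supp x)
      = ∑ y ∈ A.filter (fun y => ∀ i, y i ≤ x i), 1 / ((wt x).choose (wt y) : ℝ) := by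
    unfold gbU
    simp only [ite_div, zero_div]
    rw [← Finset.sum_filter]
    have : (supp x).powerset.filter (· ∈ A.image supp)
        = (A.filter (fun y => ∀ i, y i ≤ x i)).image supp := by
      ext z
      simp only [mem_filter, mem_powerset, mem_image]
      constructor
      · rintro ⟨hz, y, hy, rfl⟩
        exact ⟨y, ⟨hy, (supp_subset _ _).1 hz⟩, rfl⟩
      · rintro ⟨y, ⟨hy, h⟩, rfl⟩
        exact ⟨(supp_subset _ _).2 h, y, hy, rfl⟩
    rw [this, Finset.sum_image (fun a _ b _ h => supp_inj h)]
    rfl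
  rw [h1, ← Finset.sum_fiberwise_of_maps_to (g := fun y => hamm y x) (t := Finset.range (n+1))]
  · apply Finset.sum_congr rfl
    intro k hk
    rw [Finset.filter_filter]
    unfold densDown
    split_ifs with hkw
    · rw [Finset.sum_congr rfl (g := fun _ => 1 / ((wt x).choose k : ℝ))]
      · rw [Finset.sum_const, nsmul_eq_mul, mul_one_div]
      · intro y hy
        simp only [mem_filter] at hy
        have := hamm_add y x hy.2.1
        rw [← Nat.choose_symm hkw]
        congr 3
        omega
    · apply Finset.sum_eq_zero
      intro y hy
      simp only [mem_filter] at hy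
      have := hamm_add y x hy.2.1
      omega
  · intro y hy
    simp only [mem_filter] at hy
    have := hamm_add y x hy.2
    have := wt_le x
    simp only [mem_range]
    omega

lemma dens_step {n : ℕ} (x y : Fin n → Bool) (A : Finset (Fin n → Bool)) (hxy : ∀ i, x i ≤ y i)
    (h1 : hamm x y = 1) (k : ℕ) :
    ((k + 1 : ℝ) / n) * densDown x A k ≤ densDown y A (k + 1) := by
  have hw := hamm_add x y hxy
  have hyn := wt_le y
  have hwy : wt y = wt x + 1 := by omega
  by_cases hk : k ≤ wt x
  · unfold densDown
    rw [if_pos hk, if_pos (by omega), hwy]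
    have hsub : A.filter (fun z => (∀ i, z i ≤ x i) ∧ hamm z x = k)
        ⊆ A.filter (fun z => (∀ i, z i ≤ y i) ∧ hamm z y = k + 1) := by
      intro z hz
      simp only [mem_filter] at hz ⊢
      have hzy : ∀ i, z i ≤ y i := fun i => (hz.2.1 i).trans (hxy i)
      refine ⟨hz.1, hzy, ?_⟩
      have a := hamm_add z x hz.2.1
      have b := hamm_add z y hzy
      omega
    have hcard : ((#(A.filter (fun z => (∀ i, z i ≤ x i) ∧ hamm z x = k)) : ℕ) : ℝ)
        ≤ #(A.filter (fun z => (∀ i, z i ≤ y i) ∧ hamm z y = k + 1)) := by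
      exact_mod_cast Finset.card_le_card hsub
    have e : ((wt x : ℝ) + 1) * (wt x).choose k = (wt x + 1).choose (k+1) * (k+1) := by
      exact_mod_cast Nat.add_one_mul_choose_eq (wt x) k
    have p1 : (0:ℝ) < (wt x).choose k := by exact_mod_cast Nat.choose_pos hk
    have p2 : (0:ℝ) < (wt x + 1).choose (k+1) := by exact_mod_cast Nat.choose_pos (by omega)
    have hn' : (wt x : ℝ) + 1 ≤ n := by exact_mod_cast (by omega : wt x + 1 ≤ n)
    have hn0 : (0:ℝ) < n := by have : (0:ℝ) ≤ wt x := by positivity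
                               linarith
    have hq : ((k + 1 : ℝ) / n) * (1 / (wt x).choose k) ≤ 1 / (wt x + 1).choose (k+1) := by
      rw [div_mul_div_comm, div_le_div_iff₀ (by positivity) p2]
      nlinarith
    calc _ = (#(A.filter (fun z => (∀ i, z i ≤ x i) ∧ hamm z x = k)) : ℝ) *
            (((k + 1 : ℝ) / n) * (1 / (wt x).choose k)) := by ring
      _ ≤ (#(A.filter (fun z => (∀ i, z i ≤ y i) ∧ hamm z y = k + 1)) : ℝ) *
            (1 / (wt x + 1).choose (k+1)) := by
          apply mul_le_mul hcard hq (by positivity) (by positivity)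
      _ = _ := by ring
  · have : densDown x A k = 0 := by unfold densDown; rw [if_neg hk]
    rw [this, mul_zero]
    exact densDown_nonneg _ _ _

lemma bucket_step {n : ℕ} (x y : Fin n → Bool) (A : Finset (Fin n → Bool))
    (hxy : ∀ i, x i ≤ y i) (h1 : hamm x y = 1) (l : ℕ) :
    ((2:ℝ) ^ l / (2 * n)) * ∑ k ∈ bucket l, densDown x A k
      ≤ ∑ k ∈ bucket' l, densDown y A k := by
  unfold bucket'
  rw [Finset.sum_image (fun a _ b _ h => by simpa using h), Finset.mul_sum]
  apply Finset.sum_le_sum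
  intro k hk
  refine le_trans ?_ (dens_step x y A hxy h1 k)
  have hk' : (2:ℝ) ^ l ≤ 2 * (k + 1) := by
    unfold bucket at hk
    split_ifs at hk with h0
    · subst h0; simp only [mem_singleton] at hk; subst hk; norm_num
    · obtain ⟨j, rfl⟩ : ∃ j, l = j + 1 := ⟨l - 1, by omega⟩
      simp only [Nat.add_sub_cancel, mem_Ico] at hk
      have : (2:ℝ) ^ j ≤ k := by exact_mod_cast hk.1
      rw [pow_succ]; linarith
  apply mul_le_mul_of_nonneg_right _ (densDown_nonneg _ _ _)
  calc (2:ℝ) ^ l / (2 * n) ≤ 2 * (k+1) / (2 * n) := by gcongr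
    _ = _ := by rw [mul_div_mul_left _ _ (by norm_num)]

open Classical in
/-- Second moment bound. -/
lemma score_lower {n : ℕ} (hn : 1 ≤ n) (A : Finset (Fin n → Bool)) (c : ℝ) (hc : 0 ≤ c)
    (hA : ∀ x ∈ A, c ≤ n.choose (wt x)) :
    c * n * ((#A : ℝ) / 2 ^ n) ^ 2 / 2
      ≤ ∑ x ∈ A, ∑ k ∈ Finset.range (n + 1), densDown x A k := by
  set F : Finset (Fin n) → ℝ := fun z => if z ∈ A.image supp then (1:ℝ) else 0 with hF
  have hsum : ∀ G : Finset (Fin n) → ℝ, gbU (fun z => F z * G z) Finset.univ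
      = ∑ x ∈ A, G (supp x) / (n.choose (wt x) : ℝ) := by
    intro G
    unfold gbU
    simp only [hF, ite_mul, one_mul, zero_mul, ite_div, zero_div, Finset.powerset_univ]
    rw [← Finset.sum_filter]
    have : (Finset.univ : Finset (Finset (Fin n))).filter (· ∈ A.image supp) = A.image supp := by
      ext; simp
    rw [this, Finset.sum_image (fun a _ b _ h => supp_inj h)]
    simp [card_supp]
  have h1 := gbU_sq F Finset.univ
  rw [hsum] at h1
  have h2 := hsum (fun _ => 1)
  simp only [mul_one] at h2
  rw [h2] at h1
  have hn0 : (0:ℝ) < n := by exact_mod_cast hn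
  have hmid : (0:ℝ) < n.choose (n/2) := by exact_mod_cast Nat.choose_pos (Nat.div_le_self n 2)
  have hmid2 : (n:ℝ) * (n.choose (n/2) : ℝ) ^ 2 ≤ 4 ^ n := by exact_mod_cast (mid_bounds n hn).1
  have h3 : (#A : ℝ) / n.choose (n/2) ≤ ∑ x ∈ A, (1:ℝ) / n.choose (wt x) := by
    calc (#A : ℝ) / n.choose (n/2) = ∑ x ∈ A, (1:ℝ) / n.choose (n/2) := by
          rw [Finset.sum_const, nsmul_eq_mul, mul_one_div]
      _ ≤ _ := by
        apply Finset.sum_le_sum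
        intro x hx
        have : (0:ℝ) < n.choose (wt x) := by exact_mod_cast Nat.choose_pos (wt_le x)
        have : (n.choose (wt x) : ℝ) ≤ n.choose (n/2) := by
          exact_mod_cast Nat.choose_le_middle _ _
        gcongr
  have h4 : (n:ℝ) * ((#A : ℝ) / 2 ^ n) ^ 2 ≤ (∑ x ∈ A, (1:ℝ) / n.choose (wt x)) ^ 2 := by
    calc (n:ℝ) * ((#A : ℝ) / 2 ^ n) ^ 2 = (#A : ℝ)^2 * (n / 4 ^ n) := by
          rw [div_pow, ← pow_mul, mul_comm n 2, pow_mul]; norm_num; ring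
      _ ≤ (#A : ℝ)^2 * (1 / (n.choose (n/2) : ℝ)^2) := by
          gcongr ?_ * ?_
          rw [div_le_div_iff₀ (by positivity) (by positivity)]
          linarith
      _ = ((#A : ℝ) / n.choose (n/2)) ^ 2 := by ring
      _ ≤ _ := by gcongr
  have h5 : c * ∑ x ∈ A, gbU F (supp x) / (n.choose (wt x) : ℝ)
      ≤ ∑ x ∈ A, ∑ k ∈ Finset.range (n + 1), densDown x A k := by
    rw [Finset.mul_sum]
    apply Finset.sum_le_sum
    intro x hx
    rw [hF, dens_sum]
    have p : (0:ℝ) < n.choose (wt x) := by exact_mod_cast Nat.choose_pos (wt_le x)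
    have q : 0 ≤ ∑ k ∈ Finset.range (n + 1), densDown x A k :=
      Finset.sum_nonneg fun k _ => densDown_nonneg _ _ _
    rw [mul_div_assoc', div_le_iff₀ p, mul_comm]
    exact mul_le_mul_of_nonneg_left (hA x hx) q
  refine le_trans ?_ h5
  calc c * n * ((#A : ℝ) / 2 ^ n) ^ 2 / 2 = c * ((n:ℝ) * ((#A : ℝ) / 2 ^ n) ^ 2 / 2) := by ring
    _ ≤ _ := by
      apply mul_le_mul_of_nonneg_left _ hc
      linarith

lemma mPar_bound (n : ℕ) (hn : 2 ≤ n) : ((mPar n : ℝ) + 1) ≤ 3 * Real.logb 2 n := by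
  have h1 : mPar n = Nat.log 2 n + 1 := by
    unfold mPar
    apply le_antisymm
    · apply Nat.clog_le_of_le_pow
      exact Nat.lt_pow_succ_log_self (by norm_num) n
    · rw [Nat.succ_le_iff, Nat.lt_clog_iff_pow_lt (by norm_num)]
      exact Nat.lt_succ_of_le (Nat.pow_log_le_self 2 (by omega))
  have h2 : (Nat.log 2 n : ℝ) ≤ Real.logb 2 n := Real.natLog_le_logb n 2
  have h3 : 1 ≤ Real.logb 2 n := by
    rw [Real.le_logb_iff_rpow_le (by norm_num) (by positivity)]
    simp; exact_mod_cast hn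
  rw [h1]; push_cast; linarith

theorem good_bucket_exists_upper_endpoints :
    ∃ c : ℝ, 0 < c ∧ ∀ n : ℕ, 2 ≤ n → ∀ ε : ℝ, 1 / (n : ℝ) ≤ ε → ε ≤ 1 / 2 →
      ∀ M : Finset ((Fin n → Bool) × (Fin n → Bool)), ∀ σ : ℝ,
        -- `M` is a set of edges `(x, y)` with `x ≺ y`, `‖y − x‖₁ = 1`, both in `L_mid`
        (∀ e ∈ M, (∀ i, e.1 i ≤ e.2 i) ∧ hamm e.1 e.2 = 1 ∧
          e.1 ∈ Lmid n ε ∧ e.2 ∈ Lmid n ε) →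
        -- no two distinct edges of `M` share a vertex
        (∀ e ∈ M, ∀ e' ∈ M, e ≠ e' →
          e.1 ≠ e'.1 ∧ e.1 ≠ e'.2 ∧ e.2 ≠ e'.1 ∧ e.2 ≠ e'.2) →
        (M.card : ℝ) = σ * 2 ^ n →
        ∃ ℓ : ℕ, ℓ ≤ mPar n ∧
          c * 2 ^ ℓ * 2 ^ n * ε ^ 8 * σ ^ 2 /
              (Real.logb 2 n * Real.sqrt ((n : ℝ) * Real.log (1 / ε))) ≤
            ∑ y ∈ M.image Prod.snd, ∑ k ∈ bucket' ℓ, densDown y (M.image Prod.fst) k := by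
  obtain ⟨c, hc, hch⟩ := choose_lower
  refine ⟨c / 24, by positivity, ?_⟩
  intro n hn ε h1 h2 M σ hM hdis hcard
  have hn2 : (2:ℝ) ≤ n := by exact_mod_cast hn
  have hn0 : (0:ℝ) < n := by linarith
  have he : 0 < ε := lt_of_lt_of_le (by positivity) h1
  have inj1 : Set.InjOn Prod.fst (M : Set ((Fin n → Bool) × (Fin n → Bool))) := by
    intro e he e' he' h
    by_contra hne
    exact (hdis e he e' he' hne).1 h
  have inj2 : Set.InjOn Prod.snd (M : Set ((Fin n → Bool) × (Fin n → Bool))) := by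
    intro e he e' he' h
    by_contra hne
    exact (hdis e he e' he' hne).2.2.2 h
  set A := M.image Prod.fst with hA
  have hcA : (#A : ℝ) / 2 ^ n = σ := by
    rw [hA, Finset.card_image_of_injOn inj1, hcard]; field_simp
  have hsc := score_lower (by omega : 1 ≤ n) A (c * 2 ^ n * ε ^ 8 / Real.sqrt n) (by positivity) (by
    intro x hx
    obtain ⟨e, heM, rfl⟩ := Finset.mem_image.1 hx
    have hmid := (hM e heM).2.2.1
    simp only [Lmid, mem_filter, mem_univ, true_and] at hmid
    exact hch n hn ε h1 h2 _ (wt_le _) hmid.1 hmid.2)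
  rw [hcA] at hsc
  -- pigeonhole over the buckets
  have hcov : ∑ x ∈ A, ∑ k ∈ Finset.range (n + 1), densDown x A k
      ≤ ∑ l ∈ Finset.range (mPar n + 1), ∑ x ∈ A, ∑ k ∈ bucket l, densDown x A k := by
    rw [Finset.sum_comm]
    rw [Finset.sum_comm (s := Finset.range (mPar n + 1))]
    rw [Finset.sum_comm]
    apply Finset.sum_le_sum
    intro x hx
    rw [sum_buckets]
    apply Finset.sum_le_sum_of_subset_of_nonneg
    · apply Finset.range_subset_range.2
      exact Nat.le_pow_clog (by norm_num) _
    · intro k _ _; exact densDown_nonneg _ _ _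
  set T := c * 2 ^ n * ε ^ 8 / Real.sqrt n * n * σ ^ 2 / 2 with hT
  have hT0 : 0 ≤ T := by positivity
  obtain ⟨l, hl, hlT⟩ : ∃ l ∈ Finset.range (mPar n + 1),
      T / ((mPar n : ℝ) + 1) ≤ ∑ x ∈ A, ∑ k ∈ bucket l, densDown x A k := by
    apply Finset.exists_le_of_sum_le ⟨0, by simp⟩
    rw [Finset.sum_const, Finset.card_range, nsmul_eq_mul]
    push_cast
    rw [mul_div_cancel₀ _ (by positivity)]
    exact hsc.trans hcov
  refine ⟨l, by simpa [Nat.lt_succ_iff] using hl, ?_⟩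
  have hstep : ((2:ℝ) ^ l / (2 * n)) * ∑ x ∈ A, ∑ k ∈ bucket l, densDown x A k
      ≤ ∑ y ∈ M.image Prod.snd, ∑ k ∈ bucket' l, densDown y A k := by
    rw [Finset.sum_image inj2, hA, Finset.sum_image inj1, ← hA, Finset.mul_sum]
    apply Finset.sum_le_sum
    intro e heM
    exact bucket_step _ _ _ (hM e heM).1 (hM e heM).2.1 l
  refine le_trans ?_ hstep
  have hm := mPar_bound n hn
  have hmp : (0:ℝ) < (mPar n : ℝ) + 1 := by positivity
  have hlog : 0 < Real.logb 2 n := by linarith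
  have hln : (1/4 : ℝ) ≤ Real.log (1 / ε) := by
    have : Real.log 2 ≤ Real.log (1/ε) := by
      apply Real.log_le_log (by norm_num)
      rw [le_div_iff₀ he]; linarith
    have := Real.log_two_gt_d9
    linarith
  have hsqn : 0 < Real.sqrt n := Real.sqrt_pos.2 hn0
  have hsq : Real.sqrt n / 2 ≤ Real.sqrt (n * Real.log (1/ε)) := by
    apply Real.le_sqrt_of_sq_le
    rw [div_pow, Real.sq_sqrt hn0.le]
    nlinarith
  have hss : Real.sqrt n * Real.sqrt n = n := Real.mul_self_sqrt hn0.le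
  calc c / 24 * 2 ^ l * 2 ^ n * ε ^ 8 * σ ^ 2 /
        (Real.logb 2 n * Real.sqrt (n * Real.log (1/ε)))
      ≤ c / 24 * 2 ^ l * 2 ^ n * ε ^ 8 * σ ^ 2 / (Real.logb 2 n * (Real.sqrt n / 2)) := by
        gcongr
    _ = (2:ℝ) ^ l / (2 * n) * (T / (3 * Real.logb 2 n)) := by
        rw [hT]
        field_simp
        ring
    _ ≤ (2:ℝ) ^ l / (2 * n) * (T / ((mPar n : ℝ) + 1)) := by gcongr
    _ ≤ _ := by gcongr
end

section
/- There exists a universal constant c > 0 such that the following holds for all n ≥ 2, all ε with 1/n ≤ ε ≤ 1/2, and every f : {0,1}^n → {0,1}. Suppose there exists a matching M of σ·2^n violated edges of f all of whose endpoints lie in L_mid (pairs (x,y) with x ≺ y, ‖y−x‖₁ = 1, f(x) = 1, f(y) = 0, x, y ∈ L_mid, no two pairs sharing a vertex). Consider the following random experiment: pick y uniformly from L_mid; pick ℓ uniformly from {0,1,…,m} where m = ⌈log₂(n+1)⌉; pick k uniformly from B′_ℓ; if k ≤ ‖y‖₁, pick x uniformly among all z ≺ y with ‖y−z‖₁ =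 k, and otherwise declare failure. Then the probability that x is defined and (x,y) is a violated pair of f (i.e., f(x) = 1 and f(y) = 0) is at least c·ε⁸·σ² / ((log₂ n)²·√(n·ln(1/ε))). -/
open Finset

open Classical in
/-- The probability that the weighted path tester experiment succeeds on `f`:
pick `y` uniformly from `L_mid`; pick `ℓ` uniformly from `{0,…,m}`; pick `k` uniformly
from `B′_ℓ`; if `k ≤ ‖y‖₁` pick `x` uniformly among all `z ≺ y` with `‖y−z‖₁ = k`
(otherwise fail); succeed iff `f x = 1` and `f y = 0` (with `1 ↦ true`, `0 ↦ false`). -/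
noncomputable def successProb (n : ℕ) (ε : ℝ) (f : (Fin n → Bool) → Bool) : ℝ :=
  (∑ y ∈ Lmid n ε, ∑ ℓ ∈ Finset.range (mPar n + 1), ∑ k ∈ bucket' ℓ,
      (if k ≤ wt y ∧ f y = false then
          ((Finset.univ.filter
              (fun z => (∀ i, z i ≤ y i) ∧ z ≠ y ∧ hamm z y = k ∧ f z = true)).card : ℝ) /
            ((wt y).choose k : ℝ)
        else 0) / ((bucket' ℓ).card : ℝ)) /
    (((Lmid n ε).card : ℝ) * ((mPar n : ℝ) + 1))


/-! ### Auxiliary material for the proof -/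

lemma aux_central (k : ℕ) : (Nat.centralBinom k) ^ 2 * (2 * k + 1) ≤ 16 ^ k := by
  induction k with
  | zero => simp
  | succ k ih =>
    have h := Nat.succ_mul_centralBinom_succ k
    have h2 : (k + 1) ^ 2 * ((Nat.centralBinom (k + 1)) ^ 2 * (2 * (k + 1) + 1)) ≤
        (k + 1) ^ 2 * 16 ^ (k + 1) := by
      calc (k + 1) ^ 2 * ((Nat.centralBinom (k + 1)) ^ 2 * (2 * (k + 1) + 1))
          = ((k + 1) * Nat.centralBinom (k + 1)) ^ 2 * (2 * (k + 1) + 1) := by ring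
        _ = (2 * (2 * k + 1) * Nat.centralBinom k) ^ 2 * (2 * (k + 1) + 1) := by rw [h]
        _ = (4 * (2 * k + 1) * (2 * k + 3)) * ((Nat.centralBinom k) ^ 2 * (2 * k + 1)) := by ring
        _ ≤ (16 * (k + 1) ^ 2) * 16 ^ k := by
            apply Nat.mul_le_mul _ ih
            nlinarith
        _ = (k + 1) ^ 2 * 16 ^ (k + 1) := by ring
    exact Nat.le_of_mul_le_mul_left h2 (by positivity)

lemma aux_choose_sq (n j : ℕ) : (n.choose j) ^ 2 * n ≤ 4 ^ n := by
  have h1 : n.choose j ≤ n.choose (n / 2) := Nat.choose_le_middle j n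
  refine le_trans (Nat.mul_le_mul_right n (Nat.pow_le_pow_left h1 2)) ?_
  rcases Nat.even_or_odd' n with ⟨k, hk | hk⟩
  · have h2 := aux_central k
    have h3 : n / 2 = k := by omega
    rw [h3, hk, pow_mul]
    rw [Nat.centralBinom] at h2
    norm_num
    nlinarith [sq_nonneg ((2 * k).choose k)]
  · have h2 := aux_central (k + 1)
    have h3 : n / 2 = k := by omega
    have h4 : Nat.centralBinom (k + 1) = 2 * (2 * k + 1).choose k := by
      rw [Nat.centralBinom, show 2 * (k + 1) = (2 * k + 1) + 1 by ring, Nat.choose_succ_succ]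
      have : (2 * k + 1).choose (k + 1) = (2 * k + 1).choose k :=
        Nat.choose_symm_half k
      simp only [Nat.succ_eq_add_one, this]; ring
    rw [h4] at h2
    rw [h3, hk]
    have e1 : 4 ^ (2 * k + 1) = 4 * 16 ^ k := by
      rw [pow_succ, pow_mul]; norm_num; ring
    have e2 : 16 ^ (k + 1) = 16 * 16 ^ k := by ring
    rw [e1]
    rw [e2] at h2
    nlinarith [sq_nonneg ((2 * k + 1).choose k)]

section Lattice
variable {n : ℕ}

/-- Expected weighted number of points of `A` on a random path ending at `y`. -/
noncomputable def auxS (A : Finset (Finset (Fin n))) (y : Finset (Fin n)) : ℝ :=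
  ∑ x ∈ A, if x ⊆ y then (n.choose x.card : ℝ) / (y.card.choose x.card : ℝ) else 0

/-- Same as `auxS`, counting only points strictly below `y`. -/
noncomputable def auxT (A : Finset (Finset (Fin n))) (y : Finset (Fin n)) : ℝ :=
  ∑ x ∈ A, if x ⊂ y then (n.choose x.card : ℝ) / (y.card.choose x.card : ℝ) else 0

lemma auxS_nonneg (A : Finset (Finset (Fin n))) (y) : 0 ≤ auxS A y := by
  unfold auxS
  refine Finset.sum_nonneg fun x _ => ?_
  split_ifs <;> positivity

lemma auxT_nonneg (A : Finset (Finset (Fin n))) (y) : 0 ≤ auxT A y := by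
  unfold auxT
  refine Finset.sum_nonneg fun x _ => ?_
  split_ifs <;> positivity

lemma auxS_eq (A : Finset (Finset (Fin n))) (y) :
    auxS A y = auxT A y + if y ∈ A then (n.choose y.card : ℝ) else 0 := by
  unfold auxS auxT
  have : (if y ∈ A then (n.choose y.card : ℝ) else 0) =
      ∑ x ∈ A, if x = y then (n.choose y.card : ℝ) else 0 := by
    rw [Finset.sum_ite_eq']
  rw [this, ← Finset.sum_add_distrib]
  refine Finset.sum_congr rfl fun x _ => ?_
  by_cases hxy : x = y
  · subst hxy
    simp
  · have : x ⊆ y ↔ x ⊂ y := ⟨fun h => lt_of_le_of_ne h hxy, fun h => h.1⟩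
    simp [hxy, this]

lemma aux_sum_erase (A : Finset (Finset (Fin n))) (y : Finset (Fin n)) :
    ∑ i ∈ y, auxS A (y.erase i) = y.card * auxT A y := by
  unfold auxS auxT
  rw [Finset.sum_comm, Finset.mul_sum]
  refine Finset.sum_congr rfl fun x _ => ?_
  by_cases hxy : x ⊂ y
  · have hlt := Finset.card_lt_card hxy
    have h1 : ∀ i ∈ y, (if x ⊆ y.erase i then
        (n.choose x.card : ℝ) / ((y.erase i).card.choose x.card : ℝ) else 0) =
        if i ∈ y \ x then (n.choose x.card : ℝ) / ((y.card - 1).choose x.card : ℝ) else 0 := by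
      intro i hi
      rw [Finset.card_erase_of_mem hi]
      have : x ⊆ y.erase i ↔ i ∈ y \ x := by
        rw [Finset.subset_erase, Finset.mem_sdiff]
        exact ⟨fun h => ⟨hi, h.2⟩, fun h => ⟨hxy.1, h.2⟩⟩
      simp only [this]
    rw [Finset.sum_congr rfl h1, Finset.sum_ite_mem,
      Finset.inter_eq_right.mpr Finset.sdiff_subset, Finset.sum_const, nsmul_eq_mul,
      Finset.card_sdiff_of_subset hxy.1, if_pos hxy]
    obtain ⟨b, hb⟩ : ∃ b, y.card = b + 1 := ⟨y.card - 1, by omega⟩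
    rw [hb] at hlt ⊢
    have h2 := Nat.choose_mul_succ_eq b x.card
    have h3 : (b.choose x.card : ℝ) * ((b + 1 : ℕ) : ℝ) =
      ((b + 1).choose x.card : ℝ) * ((b + 1 - x.card : ℕ) : ℝ) := by exact_mod_cast h2
    have p1 : (0 : ℝ) < b.choose x.card := by
      exact_mod_cast Nat.choose_pos (by omega)
    have p2 : (0 : ℝ) < (b + 1).choose x.card := by
      exact_mod_cast Nat.choose_pos (by omega)
    simp only [Nat.add_sub_cancel]
    field_simp
    linear_combination (-(n.choose x.card : ℝ)) * h3
  · rw [if_neg hxy, mul_zero]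
    refine Finset.sum_eq_zero fun i hi => ?_
    rw [if_neg]
    intro h
    exact hxy (lt_of_le_of_lt h (Finset.erase_ssubset hi))

lemma aux_double (b : ℕ) (F : Finset (Fin n) → ℝ) :
    ∑ y ∈ powersetCard (b + 1) (univ : Finset (Fin n)), ∑ i ∈ y, F (y.erase i) =
      ((n - b : ℕ) : ℝ) * ∑ z ∈ powersetCard b (univ : Finset (Fin n)), F z := by
  have h : ∀ z ∈ powersetCard b (univ : Finset (Fin n)),
      ((n - b : ℕ) : ℝ) * F z = ∑ i ∈ zᶜ, F z := by
    intro z hz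
    rw [Finset.sum_const, nsmul_eq_mul, Finset.card_compl, (mem_powersetCard.mp hz).2,
      Fintype.card_fin]
  rw [Finset.mul_sum, Finset.sum_congr rfl h, Finset.sum_sigma', Finset.sum_sigma']
  refine Finset.sum_bij' (fun p _ => ⟨p.1.erase p.2, p.2⟩) (fun p _ => ⟨insert p.2 p.1, p.2⟩)
    ?_ ?_ ?_ ?_ ?_
  · rintro ⟨y, i⟩ hp
    simp only [mem_sigma, mem_powersetCard, subset_univ, true_and, mem_compl] at hp ⊢
    refine ⟨?_, by simp⟩
    rw [Finset.card_erase_of_mem hp.2]; omega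
  · rintro ⟨z, i⟩ hp
    simp only [mem_sigma, mem_powersetCard, subset_univ, true_and, mem_compl] at hp ⊢
    refine ⟨?_, by simp⟩
    rw [Finset.card_insert_of_notMem hp.2]; omega
  · rintro ⟨y, i⟩ hp
    simp only [mem_sigma] at hp
    simp [Finset.insert_erase hp.2]
  · rintro ⟨z, i⟩ hp
    simp only [mem_sigma, mem_compl] at hp
    simp [Finset.erase_insert hp.2]
  · rintro ⟨y, i⟩ hp
    rfl

lemma aux_step (A : Finset (Finset (Fin n))) (b : ℕ) (hb : b + 1 ≤ n) :
    (∑ y ∈ powersetCard (b + 1) (univ : Finset (Fin n)), (auxT A y) ^ 2) / (n.choose (b + 1)) ≤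
    (∑ y ∈ powersetCard b (univ : Finset (Fin n)), (auxS A y) ^ 2) / (n.choose b) := by
  have h1 : ((b : ℝ) + 1) * ∑ y ∈ powersetCard (b + 1) (univ : Finset (Fin n)), (auxT A y) ^ 2 ≤
      ∑ y ∈ powersetCard (b + 1) (univ : Finset (Fin n)), ∑ i ∈ y, (auxS A (y.erase i)) ^ 2 := by
    rw [Finset.mul_sum]
    refine Finset.sum_le_sum fun y hy => ?_
    have hc := (mem_powersetCard.mp hy).2
    have h2 := aux_sum_erase A y
    have h3 := sq_sum_le_card_mul_sum_sq (s := y) (f := fun i => auxS A (y.erase i))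
    rw [h2, hc] at h3
    push_cast at h3
    have : (0 : ℝ) < (b : ℝ) + 1 := by positivity
    refine le_of_mul_le_mul_left ?_ this
    calc _ = (((b : ℝ) + 1) * auxT A y) ^ 2 := by ring
      _ ≤ _ := h3
  rw [aux_double b (fun z => (auxS A z) ^ 2)] at h1
  have h4 : (n.choose (b + 1) : ℝ) * ((b : ℝ) + 1) = (n.choose b : ℝ) * ((n - b : ℕ) : ℝ) := by
    exact_mod_cast Nat.choose_succ_right_eq n b
  have p1 : (0 : ℝ) < n.choose (b + 1) := by exact_mod_cast Nat.choose_pos hb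
  have p2 : (0 : ℝ) < n.choose b := by exact_mod_cast Nat.choose_pos (by omega)
  rw [div_le_div_iff₀ p1 p2]
  have : (0 : ℝ) < (b : ℝ) + 1 := by positivity
  refine le_of_mul_le_mul_left ?_ this
  calc ((b : ℝ) + 1) * ((∑ y ∈ powersetCard (b + 1) (univ : Finset (Fin n)), (auxT A y) ^ 2) *
        (n.choose b : ℝ))
      = (((b : ℝ) + 1) * ∑ y ∈ powersetCard (b + 1) (univ : Finset (Fin n)), (auxT A y) ^ 2) *
        (n.choose b : ℝ) := by ring
    _ ≤ _ := mul_le_mul_of_nonneg_right h1 p2.le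
    _ = (∑ z ∈ powersetCard b (univ : Finset (Fin n)), (auxS A z) ^ 2) *
        ((n.choose b : ℝ) * ((n - b : ℕ) : ℝ)) := by ring
    _ = _ := by rw [← h4]; ring

lemma aux_layer (A : Finset (Finset (Fin n))) (b : ℕ) (hb : b ≤ n) :
    (∑ y ∈ powersetCard b (univ : Finset (Fin n)), (auxS A y) ^ 2) / (n.choose b) ≤
    (∑ y ∈ powersetCard b (univ : Finset (Fin n)), (auxT A y) ^ 2) / (n.choose b) +
      2 * ∑ y ∈ A with y.card = b, auxS A y := by
  have p2 : (0 : ℝ) < n.choose b := by exact_mod_cast Nat.choose_pos hb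
  have e : ∑ y ∈ A with y.card = b, auxS A y =
      ∑ y ∈ powersetCard b (univ : Finset (Fin n)), if y ∈ A then auxS A y else 0 := by
    rw [← Finset.sum_filter]
    refine Finset.sum_congr ?_ fun _ _ => rfl
    ext y
    simp [mem_powersetCard, and_comm]
  rw [e, div_add' _ _ _ p2.ne', div_le_div_iff_of_pos_right p2, Finset.mul_sum, Finset.sum_mul,
    ← Finset.sum_add_distrib]
  refine Finset.sum_le_sum fun y hy => ?_
  have hc := (mem_powersetCard.mp hy).2
  have h1 := auxS_eq A y
  have h2 := auxT_nonneg A y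
  rw [hc] at h1
  by_cases hA : y ∈ A
  · rw [if_pos hA] at h1 ⊢
    rw [h1]
    nlinarith
  · rw [if_neg hA] at h1 ⊢
    rw [h1]; simp

lemma aux_induct (A : Finset (Finset (Fin n))) (b : ℕ) (hb : b ≤ n) :
    (∑ y ∈ powersetCard b (univ : Finset (Fin n)), (auxS A y) ^ 2) / (n.choose b) ≤
      2 * ∑ y ∈ A with y.card ≤ b, auxS A y := by
  induction b with
  | zero =>
    have h := aux_layer A 0 hb
    have hT : auxT A ∅ = 0 := by
      unfold auxT
      refine Finset.sum_eq_zero fun x _ => ?_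
      rw [if_neg (Finset.not_ssubset_empty x)]
    have h0 : ∑ y ∈ powersetCard 0 (univ : Finset (Fin n)), (auxT A y) ^ 2 = 0 := by
      simp [hT]
    rw [h0, zero_div, zero_add] at h
    simpa only [Nat.le_zero] using h
  | succ b ih =>
    have h := aux_layer A (b + 1) hb
    have h1 := aux_step A b hb
    have h2 := ih (by omega)
    have e : ∑ y ∈ A with y.card ≤ b + 1, auxS A y =
        ∑ y ∈ A with y.card ≤ b, auxS A y + ∑ y ∈ A with y.card = b + 1, auxS A y := by
      rw [← Finset.sum_union]
      · refine Finset.sum_congr ?_ fun _ _ => rfl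
        ext y
        simp only [mem_filter, mem_union]
        constructor
        · rintro ⟨h, h'⟩
          rcases Nat.le_succ_iff.mp h' with h'' | h''
          · exact Or.inl ⟨h, h''⟩
          · exact Or.inr ⟨h, h''⟩
        · rintro (⟨h, h'⟩ | ⟨h, h'⟩)
          · exact ⟨h, by omega⟩
          · exact ⟨h, by omega⟩
      · rw [Finset.disjoint_left]
        intro y hy hy'
        simp only [mem_filter] at hy hy'
        omega
    rw [e]
    linarith

lemma aux_main (A : Finset (Finset (Fin n))) :
    (A.card : ℝ) ^ 2 ≤ 2 * ∑ y ∈ A, auxS A y := by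
  have h := aux_induct A n le_rfl
  have e1 : powersetCard n (univ : Finset (Fin n)) = {univ} := by
    have := Finset.powersetCard_self (univ : Finset (Fin n))
    rwa [Finset.card_univ, Fintype.card_fin] at this
  have e2 : auxS A univ = A.card := by
    unfold auxS
    have : ∀ x ∈ A, (if x ⊆ (univ : Finset (Fin n)) then
        (n.choose x.card : ℝ) / ((univ : Finset (Fin n)).card.choose x.card : ℝ) else 0) = 1 := by
      intro x _
      rw [if_pos (Finset.subset_univ x), Finset.card_univ, Fintype.card_fin, div_self]
      have : x.card ≤ n := by simpa using Finset.card_le_univ x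
      exact_mod_cast (Nat.choose_pos this).ne'
    rw [Finset.sum_congr rfl this]; simp
  have e3 : A.filter (fun y => y.card ≤ n) = A := by
    refine Finset.filter_true_of_mem fun y _ => ?_
    simpa using Finset.card_le_univ y
  rw [e1, e3, Finset.sum_singleton, e2, Nat.choose_self] at h
  simpa using h

/-- The unweighted version. -/
noncomputable def auxP (A : Finset (Finset (Fin n))) (y : Finset (Fin n)) : ℝ :=
  ∑ x ∈ A, if x ⊆ y then 1 / (y.card.choose x.card : ℝ) else 0

lemma aux_main' (A : Finset (Finset (Fin n))) :
    (A.card : ℝ) ^ 2 * Real.sqrt n ≤ 2 * 2 ^ n * ∑ y ∈ A, auxP A y := by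
  have hN : ∀ j, (n.choose j : ℝ) * Real.sqrt n ≤ 2 ^ n := by
    intro j
    have h : ((n.choose j : ℝ)) ^ 2 * n ≤ 4 ^ n := by exact_mod_cast aux_choose_sq n j
    refine le_of_sq_le_sq ?_ (by positivity)
    rw [mul_pow, Real.sq_sqrt (Nat.cast_nonneg n), ← pow_mul, mul_comm n 2, pow_mul]
    norm_num
    exact h
  have h2 : (∑ y ∈ A, auxS A y) * Real.sqrt n ≤ 2 ^ n * ∑ y ∈ A, auxP A y := by
    rw [Finset.sum_mul, Finset.mul_sum]
    refine Finset.sum_le_sum fun y _ => ?_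
    unfold auxS auxP
    rw [Finset.sum_mul, Finset.mul_sum]
    refine Finset.sum_le_sum fun x _ => ?_
    split_ifs with h
    · rw [div_mul_eq_mul_div, mul_one_div]
      exact div_le_div_of_nonneg_right (hN _) (by positivity)
    · simp
  calc _ ≤ (2 * ∑ y ∈ A, auxS A y) * Real.sqrt n :=
        mul_le_mul_of_nonneg_right (aux_main A) (Real.sqrt_nonneg _)
    _ = 2 * ((∑ y ∈ A, auxS A y) * Real.sqrt n) := by ring
    _ ≤ 2 * (2 ^ n * ∑ y ∈ A, auxP A y) := by linarith
    _ = _ := by ring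

end Lattice

section Translate
variable {n : ℕ}

/-- The support of a Boolean vector. -/
def auxSupp (x : Fin n → Bool) : Finset (Fin n) := Finset.univ.filter (fun i => x i = true)

lemma auxSupp_card (x : Fin n → Bool) : (auxSupp x).card = wt x := rfl

lemma auxSupp_inj : Function.Injective (auxSupp (n := n)) := by
  intro x y h
  funext i
  have : i ∈ auxSupp x ↔ i ∈ auxSupp y := by rw [h]
  simp only [auxSupp, mem_filter, mem_univ, true_and] at this
  exact Bool.eq_iff_iff.mpr this

lemma auxSupp_subset (x y : Fin n → Bool) : auxSupp x ⊆ auxSupp y ↔ ∀ i, x i ≤ y i := by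
  simp only [auxSupp, Finset.subset_iff, mem_filter, mem_univ, true_and]
  refine forall_congr' fun i => ?_
  cases x i <;> cases y i <;> decide

lemma aux_hamm (x y : Fin n → Bool) (h : ∀ i, x i ≤ y i) : hamm x y + wt x = wt y := by
  have e : (Finset.univ.filter (fun i => x i ≠ y i)) = auxSupp y \ auxSupp x := by
    ext i
    simp only [auxSupp, mem_filter, mem_univ, true_and, mem_sdiff]
    have := h i
    revert this
    cases x i <;> cases y i <;> decide
  have hs := (auxSupp_subset x y).mpr h
  unfold hamm
  rw [e, ← auxSupp_card, ← auxSupp_card]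
  exact Finset.card_sdiff_add_card_eq_card hs

lemma aux_bucket_card (l j : ℕ) (hj : j ∈ bucket l) : (bucket' l).card ≤ j + 1 := by
  unfold bucket'
  rw [Finset.card_image_of_injective _ (add_left_injective 1)]
  unfold bucket at hj ⊢
  split_ifs at hj ⊢ with h
  · simp
  · rw [Nat.card_Ico]
    rw [mem_Ico] at hj
    have : 2 ^ l = 2 * 2 ^ (l - 1) := by
      rw [← pow_succ']; congr 1; omega
    omega

lemma aux_bucket_card_pos (l j : ℕ) (hj : j ∈ bucket l) : 0 < (bucket' l).card := by
  unfold bucket'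
  rw [Finset.card_image_of_injective _ (add_left_injective 1)]
  exact Finset.card_pos.mpr ⟨j, hj⟩

lemma aux_bucket_sum (m : ℕ) (h : ℕ → ℝ) :
    ∑ l ∈ range (m + 1), ∑ j ∈ bucket l, h j = ∑ j ∈ range (2 ^ m), h j := by
  induction m with
  | zero => simp [bucket]
  | succ m ih =>
    rw [Finset.sum_range_succ, ih]
    have : bucket (m + 1) = Ico (2 ^ m) (2 ^ (m + 1)) := by simp [bucket]
    rw [this]
    exact Finset.sum_range_add_sum_Ico h (Nat.pow_le_pow_right (by norm_num) (by omega))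

lemma aux_bucket_le (m : ℕ) (g : ℕ → ℝ) (hg : ∀ k, 0 ≤ g k) :
    ∑ j ∈ range (2 ^ m), g (j + 1) / ((j : ℝ) + 1) ≤
    ∑ l ∈ range (m + 1), ∑ k ∈ bucket' l, g k / ((bucket' l).card : ℝ) := by
  rw [← aux_bucket_sum m (fun j => g (j + 1) / ((j : ℝ) + 1))]
  refine Finset.sum_le_sum fun l _ => ?_
  have : ∀ c : ℝ, ∑ k ∈ bucket' l, g k / c = ∑ j ∈ bucket l, g (j + 1) / c := by
    intro c
    unfold bucket'
    rw [Finset.sum_image (fun a _ b _ h => by simpa using h)]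
  rw [this]
  refine Finset.sum_le_sum fun j hj => ?_
  refine div_le_div_of_nonneg_left (hg _) ?_ ?_
  · exact_mod_cast aux_bucket_card_pos l j hj
  · exact_mod_cast aux_bucket_card l j hj

lemma auxP_eq (A : Finset (Finset (Fin n))) (y : Finset (Fin n)) :
    auxP A y = ∑ j ∈ range (y.card + 1),
      ((A.filter (fun u => u ⊆ y ∧ u.card + j = y.card)).card : ℝ) / (y.card.choose j : ℝ) := by
  unfold auxP
  rw [← Finset.sum_filter]
  rw [← Finset.sum_fiberwise_of_maps_to (s := A.filter (fun u => u ⊆ y))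
    (t := range (y.card + 1)) (g := fun u => y.card - u.card)]
  · refine Finset.sum_congr rfl fun j hj => ?_
    have hj' : j ≤ y.card := by simpa [Nat.lt_succ_iff] using hj
    have e : ((A.filter (fun u => u ⊆ y)).filter (fun u => y.card - u.card = j)) =
        A.filter (fun u => u ⊆ y ∧ u.card + j = y.card) := by
      ext u
      simp only [mem_filter, and_assoc]
      refine and_congr_right fun _ => and_congr_right fun hu => ?_
      have := Finset.card_le_card hu
      omega
    rw [e]
    have : ∀ u ∈ A.filter (fun u => u ⊆ y ∧ u.card + j = y.card),
        1 / (y.card.choose u.card : ℝ) = 1 / (y.card.choose j : ℝ) := by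
      intro u hu
      simp only [mem_filter] at hu
      rw [Nat.choose_symm_of_eq_add hu.2.2.symm]
    rw [Finset.sum_congr rfl this, Finset.sum_const, nsmul_eq_mul, mul_one_div]
  · intro u _
    simp only [mem_range]
    omega

open Classical in
lemma aux_edge (f : (Fin n → Bool) → Bool) (A : Finset (Finset (Fin n)))
    (hA : ∀ u ∈ A, ∃ z, auxSupp z = u ∧ f z = true) (x y : Fin n → Bool)
    (hxy : ∀ i, x i ≤ y i) (h1 : hamm x y = 1) (hy : f y = false) (m : ℕ) (hm : n ≤ 2 ^ m) :
    auxP A (auxSupp x) / n ≤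
    ∑ l ∈ range (m + 1), ∑ k ∈ bucket' l,
      (if k ≤ wt y ∧ f y = false then
          ((Finset.univ.filter
              (fun z => (∀ i, z i ≤ y i) ∧ z ≠ y ∧ hamm z y = k ∧ f z = true)).card : ℝ) /
            ((wt y).choose k : ℝ)
        else 0) / ((bucket' l).card : ℝ) := by
  refine le_trans ?_ (aux_bucket_le m (fun k => if k ≤ wt y ∧ f y = false then
          ((Finset.univ.filter
              (fun z => (∀ i, z i ≤ y i) ∧ z ≠ y ∧ hamm z y = k ∧ f z = true)).card : ℝ) /
            ((wt y).choose k : ℝ)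
        else 0) ?_)
  swap
  · intro k
    split_ifs <;> positivity
  have hw : wt y = wt x + 1 := by
    have := aux_hamm x y hxy
    omega
  have hyn : wt y ≤ n := by
    rw [← auxSupp_card]; simpa using Finset.card_le_univ (auxSupp y)
  have hpos : (0 : ℝ) < n := by
    have : 0 < n := by omega
    exact_mod_cast this
  rw [auxP_eq, auxSupp_card, Finset.sum_div]
  have hsub : range (wt x + 1) ⊆ range (2 ^ m) := by
    intro j hj
    rw [mem_range] at hj ⊢
    omega
  refine le_trans ?_ (Finset.sum_le_sum_of_subset_of_nonneg hsub ?_)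
  swap
  · intro j _ _
    split_ifs <;> positivity
  refine Finset.sum_le_sum fun j hj => ?_
  have hj' : j ≤ wt x := by
    rw [mem_range] at hj
    omega
  rw [if_pos ⟨by omega, hy⟩]
  set Z := Finset.univ.filter
    (fun z => (∀ i, z i ≤ y i) ∧ z ≠ y ∧ hamm z y = j + 1 ∧ f z = true) with hZ
  have hcard : (A.filter (fun u => u ⊆ auxSupp x ∧ u.card + j = wt x)).card ≤ Z.card := by
    refine le_trans (Finset.card_le_card ?_) (Finset.card_image_le (s := Z) (f := auxSupp))
    intro u hu
    simp only [mem_filter] at hu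
    obtain ⟨huA, hux, huc⟩ := hu
    obtain ⟨z, rfl, hz⟩ := hA u huA
    rw [mem_image]
    refine ⟨z, ?_, rfl⟩
    have hzy : ∀ i, z i ≤ y i := fun i => le_trans ((auxSupp_subset z x).mp hux i) (hxy i)
    have hh := aux_hamm z y hzy
    rw [auxSupp_card] at huc
    rw [hZ, mem_filter]
    refine ⟨mem_univ _, hzy, ?_, by omega, hz⟩
    rintro rfl
    omega
  have hcard' : ((A.filter (fun u => u ⊆ auxSupp x ∧ u.card + j = wt x)).card : ℝ) ≤ Z.card := by
    exact_mod_cast hcard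
  have hc : ((wt x : ℝ) + 1) * ((wt x).choose j : ℝ) =
      ((wt x + 1).choose (j + 1) : ℝ) * ((j : ℝ) + 1) := by
    exact_mod_cast Nat.add_one_mul_choose_eq (wt x) j
  have p1 : (0 : ℝ) < (wt x).choose j := by exact_mod_cast Nat.choose_pos hj'
  have hn' : (wt x : ℝ) + 1 ≤ n := by
    rw [hw] at hyn
    exact_mod_cast hyn
  rw [hw, div_div, div_div, ← hc]
  refine div_le_div₀ (by positivity) hcard' (by positivity) ?_
  rw [mul_comm ((wt x).choose j : ℝ)]
  exact mul_le_mul_of_nonneg_right hn' p1.le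

end Translate

lemma aux_mPar (n : ℕ) (hn : 2 ≤ n) : ((mPar n : ℝ) + 1) ≤ 3 * Real.logb 2 n ∧
    1 ≤ Real.logb 2 n ∧ n ≤ 2 ^ mPar n := by
  have h1 : (1 : ℝ) ≤ Real.logb 2 n := by
    rw [Real.le_logb_iff_rpow_le (by norm_num) (by positivity)]
    simpa using (by exact_mod_cast hn : (2 : ℝ) ≤ n)
  have h2 : n + 1 ≤ 2 ^ mPar n := Nat.le_pow_clog (by norm_num) _
  refine ⟨?_, h1, by omega⟩
  have h3 : 2 ^ (mPar n).pred < n + 1 := Nat.pow_pred_clog_lt_self (by norm_num) (by omega)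
  have hmpos : 1 ≤ mPar n := by
    by_contra h
    have : mPar n = 0 := by omega
    rw [this] at h2
    omega
  have h4 : ((mPar n).pred : ℝ) ≤ Real.logb 2 n := by
    rw [Real.le_logb_iff_rpow_le (by norm_num) (by positivity), Real.rpow_natCast]
    have : 2 ^ (mPar n).pred ≤ n := by omega
    exact_mod_cast this
  have h5 : (((mPar n).pred : ℕ) : ℝ) = (mPar n : ℝ) - 1 := by
    rw [Nat.pred_eq_sub_one, Nat.cast_sub hmpos]; simp
  rw [h5] at h4
  linarith

lemma aux_final (n : ℕ) (hn : 2 ≤ n) (ε : ℝ) (hε0 : 0 < ε) (hε : ε ≤ 1 / 2) (σ L P m N S : ℝ)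
    (hL : 1 ≤ L) (hm0 : 0 < m) (hm : m ≤ 3 * L) (hN0 : 0 < N) (hN : N ≤ 2 ^ n)
    (hP : (σ * 2 ^ n) ^ 2 * Real.sqrt n ≤ 2 * 2 ^ n * P) (hS : P / n ≤ S) :
    (1 / 12) * ε ^ 8 * σ ^ 2 / (L ^ 2 * Real.sqrt ((n : ℝ) * Real.log (1 / ε))) ≤
      S / (N * m) := by
  have hnpos : (0 : ℝ) < n := by
    have : 0 < n := by omega
    exact_mod_cast this
  set r := Real.sqrt n with hr
  have hr0 : 0 < r := Real.sqrt_pos.mpr hnpos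
  have hrr : r * r = n := Real.mul_self_sqrt hnpos.le
  have h2 : (0 : ℝ) < 2 ^ n := by positivity
  have hP' : σ ^ 2 * 2 ^ n * r / 2 ≤ P := by
    refine le_of_mul_le_mul_left ?_ (by positivity : (0 : ℝ) < 2 * 2 ^ n)
    calc _ = (σ * 2 ^ n) ^ 2 * r := by ring
      _ ≤ _ := hP
  have hP0 : 0 ≤ P := le_trans (by positivity) hP'
  have hS' : σ ^ 2 * 2 ^ n / (2 * r) ≤ S := by
    refine le_trans ?_ hS
    rw [le_div_iff₀ hnpos, ← hrr]
    calc _ = σ ^ 2 * 2 ^ n * r / 2 := by field_simp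
      _ ≤ _ := hP'
  have hlog : (1 : ℝ) / 4 ≤ Real.log (1 / ε) := by
    have : Real.log 2 ≤ Real.log (1 / ε) := by
      apply Real.log_le_log (by norm_num)
      rw [le_div_iff₀ hε0]; linarith
    have := Real.log_two_gt_d9
    linarith
  have hsq : r / 2 ≤ Real.sqrt ((n : ℝ) * Real.log (1 / ε)) := by
    apply Real.le_sqrt_of_sq_le
    have : (r / 2) ^ 2 = n * (1 / 4) := by rw [← hrr]; ring
    rw [this]
    exact mul_le_mul_of_nonneg_left hlog hnpos.le
  have hε8 : ε ^ 8 ≤ 1 := pow_le_one₀ hε0.le (by linarith)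
  have hLL : L ≤ L ^ 2 := by nlinarith
  calc (1 / 12) * ε ^ 8 * σ ^ 2 / (L ^ 2 * Real.sqrt ((n : ℝ) * Real.log (1 / ε)))
      ≤ (1 / 12) * 1 * σ ^ 2 / (L * (r / 2)) := by gcongr
    _ = (σ ^ 2 * 2 ^ n / (2 * r)) / (2 ^ n * (3 * L)) := by field_simp; ring
    _ ≤ S / (N * m) := by gcongr; exact le_trans (by positivity) hS'


theorem weighted_path_tester_success :
    ∃ c : ℝ, 0 < c ∧ ∀ n : ℕ, 2 ≤ n → ∀ ε : ℝ, 1 / (n : ℝ) ≤ ε → ε ≤ 1 / 2 →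
      ∀ f : (Fin n → Bool) → Bool,
      ∀ M : Finset ((Fin n → Bool) × (Fin n → Bool)), ∀ σ : ℝ,
        -- `M` is a matching of violated edges of `f` lying in the middle layers:
        (∀ e ∈ M, (∀ i, e.1 i ≤ e.2 i) ∧ hamm e.1 e.2 = 1 ∧
          f e.1 = true ∧ f e.2 = false ∧ e.1 ∈ Lmid n ε ∧ e.2 ∈ Lmid n ε) →
        (∀ e ∈ M, ∀ e' ∈ M, e ≠ e' →
          e.1 ≠ e'.1 ∧ e.1 ≠ e'.2 ∧ e.2 ≠ e'.1 ∧ e.2 ≠ e'.2) →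
        (M.card : ℝ) = σ * 2 ^ n →
        c * ε ^ 8 * σ ^ 2 / ((Real.logb 2 n) ^ 2 * Real.sqrt ((n : ℝ) * Real.log (1 / ε))) ≤
          successProb n ε f := by
  refine ⟨1 / 12, by norm_num, ?_⟩
  intro n hn ε hε1 hε2 f M σ hM hmatch hcard
  have hnpos : (0 : ℝ) < n := by
    have : 0 < n := by omega
    exact_mod_cast this
  have hε0 : 0 < ε := lt_of_lt_of_le (by positivity) hε1
  obtain ⟨hm1, hL, hm2⟩ := aux_mPar n hn
  rcases M.eq_empty_or_nonempty with hME | ⟨e₀, he₀⟩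
  · have hσ : σ = 0 := by
      rw [hME] at hcard
      simp only [Finset.card_empty, Nat.cast_zero] at hcard
      rcases mul_eq_zero.mp hcard.symm with h | h
      · exact h
      · exact absurd h (by positivity)
    rw [hσ]
    simp only [ne_eq, OfNat.ofNat_ne_zero, not_false_eq_true, zero_pow, mul_zero, zero_div]
    unfold successProb
    refine div_nonneg ?_ (by positivity)
    refine Finset.sum_nonneg fun y _ => Finset.sum_nonneg fun l _ => Finset.sum_nonneg fun k _ => ?_
    split_ifs <;> positivity
  set A : Finset (Finset (Fin n)) := M.image (fun e => auxSupp e.1) with hAdef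
  have hinj : Set.InjOn (fun e : (Fin n → Bool) × (Fin n → Bool) => auxSupp e.1) M := by
    intro e he e' he' h
    by_contra hne
    exact (hmatch e he e' he' hne).1 (auxSupp_inj h)
  have hinj2 : Set.InjOn (fun e : (Fin n → Bool) × (Fin n → Bool) => e.2) M := by
    intro e he e' he' h
    by_contra hne
    exact (hmatch e he e' he' hne).2.2.2 h
  have hAc : A.card = M.card := Finset.card_image_of_injOn hinj
  have hA : ∀ u ∈ A, ∃ z, auxSupp z = u ∧ f z = true := by
    intro u hu
    obtain ⟨e, he, rfl⟩ := Finset.mem_image.mp hu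
    exact ⟨e.1, rfl, (hM e he).2.2.1⟩
  have hmain := aux_main' A
  rw [hAc, hcard] at hmain
  have hNpos : (0 : ℝ) < (Lmid n ε).card := by
    exact_mod_cast Finset.card_pos.mpr ⟨e₀.1, (hM e₀ he₀).2.2.2.2.1⟩
  have hN : ((Lmid n ε).card : ℝ) ≤ 2 ^ n := by
    have : (Lmid n ε).card ≤ 2 ^ n := by
      simpa using Finset.card_le_univ (Lmid n ε)
    exact_mod_cast this
  unfold successProb
  refine aux_final n hn ε hε0 hε2 σ (Real.logb 2 n) (∑ y ∈ A, auxP A y) _ _ _ hL (by positivity)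
    hm1 hNpos hN hmain ?_
  rw [hAdef, Finset.sum_image hinj, ← hAdef, Finset.sum_div]
  have hsub : M.image (fun e => e.2) ⊆ Lmid n ε := by
    intro y hy
    obtain ⟨e, he, rfl⟩ := Finset.mem_image.mp hy
    exact (hM e he).2.2.2.2.2
  refine le_trans ?_ (Finset.sum_le_sum_of_subset_of_nonneg hsub ?_)
  swap
  · intro y _ _
    refine Finset.sum_nonneg fun l _ => Finset.sum_nonneg fun k _ => ?_
    split_ifs <;> positivity
  rw [Finset.sum_image hinj2]
  refine Finset.sum_le_sum fun e he => ?_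
  obtain ⟨h1, h2, -, h4, -, -⟩ := hM e he
  exact aux_edge f A hA e.1 e.2 h1 h2 h4 (mPar n) hm2
end
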